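/- For every complex number z with ‖z‖ < 1, the Jacobi theta identity ϑ₃(q)² = ϑ₃(q²)² + ϑ₂(q²)² holds; in the variable z = q^{1/8} this reads (∑_{n ∈ ℤ} z^{4n²})² = (∑_{n ∈ ℤ} z^{8n²})² + (∑_{n ∈ ℤ} z^{2(2n+1)²})², where all series converge absolutely. -/

import Mathlib

theorem summable_norm_pow_of_natAbs_le {z : ℂ} (hz : ‖z‖ < 1) {e : ℤ → ℕ}
    (he : ∀ n, n.natAbs ≤ e n) : Summable (fun n : ℤ => ‖z ^ e n‖) := by
  have hgeom : Summable (fun n : ℕ => ‖z‖ ^ n) :=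
    summable_geometric_of_lt_one (norm_nonneg z) hz
  have habs : Summable (fun n : ℤ => ‖z‖ ^ n.natAbs) :=
    Summable.of_nat_of_neg (by simpa using hgeom) (by simpa using hgeom)
  refine habs.of_nonneg_of_le (fun n => norm_nonneg _) fun n => ?_
  rw [norm_pow]
  exact pow_le_pow_of_le_one (norm_nonneg z) hz.le (he n)

/-- Pairs of integers split according to the parity of the sum of their coordinates, each class
being parametrized by a rotation of the lattice. -/
noncomputable def intProdParityEquiv : (ℤ × ℤ) ⊕ (ℤ × ℤ) ≃ ℤ × ℤ :=
  Equiv.ofBijective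
    (Sum.elim (fun p => (p.1 + p.2, p.1 - p.2)) (fun p => (p.1 + p.2 + 1, p.1 - p.2))) <| by
    constructor
    · rintro (⟨a, b⟩ | ⟨a, b⟩) (⟨c, d⟩ | ⟨c, d⟩) h <;>
        simp only [Sum.elim_inl, Sum.elim_inr, Prod.mk.injEq, Sum.inl.injEq, Sum.inr.injEq,
          reduceCtorEq] at h ⊢ <;> omega
    · rintro ⟨a, b⟩
      rcases Int.even_or_odd (a + b) with ⟨k, hk⟩ | ⟨k, hk⟩
      · exact ⟨Sum.inl (k, a - k), by simp only [Sum.elim_inl, Prod.mk.injEq]; omega⟩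
      · exact ⟨Sum.inr (k, a - k - 1), by simp only [Sum.elim_inr, Prod.mk.injEq]; omega⟩

theorem sq_tsum_eq_tsum_prod {f : ℤ → ℂ} (hf : Summable fun n => ‖f n‖) :
    (∑' n, f n) ^ 2 = ∑' p : ℤ × ℤ, f p.1 * f p.2 := by
  rw [sq, tsum_mul_tsum_of_summable_norm hf hf]

/-- The Jacobi theta identity `ϑ₃(q)² = ϑ₃(q²)² + ϑ₂(q²)²` ((T5) in the paper),
written in the variable `z = q^{1/8}` so that all exponents are nonnegative
integers: `(∑_{n ∈ ℤ} z^{4n²})² = (∑_{n ∈ ℤ} z^{8n²})² + (∑_{n ∈ ℤ} z^{2(2n+1)²})²`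
for `‖z‖ < 1`, all three series converging absolutely. -/
theorem stmt_10 (z : ℂ) (hz : ‖z‖ < 1) :
    Summable (fun n : ℤ => ‖z ^ (4 * n.natAbs ^ 2)‖) ∧
    Summable (fun n : ℤ => ‖z ^ (8 * n.natAbs ^ 2)‖) ∧
    Summable (fun n : ℤ => ‖z ^ (2 * (2 * n + 1).natAbs ^ 2)‖) ∧
    (∑' n : ℤ, z ^ (4 * n.natAbs ^ 2)) ^ 2 =
      (∑' n : ℤ, z ^ (8 * n.natAbs ^ 2)) ^ 2 +
        (∑' n : ℤ, z ^ (2 * (2 * n + 1).natAbs ^ 2)) ^ 2 := by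
  have h₄ : Summable (fun n : ℤ => ‖z ^ (4 * n.natAbs ^ 2)‖) :=
    summable_norm_pow_of_natAbs_le hz fun n => by nlinarith [Nat.le_self_pow two_ne_zero n.natAbs]
  have h₈ : Summable (fun n : ℤ => ‖z ^ (8 * n.natAbs ^ 2)‖) :=
    summable_norm_pow_of_natAbs_le hz fun n => by nlinarith [Nat.le_self_pow two_ne_zero n.natAbs]
  have h₂ : Summable (fun n : ℤ => ‖z ^ (2 * (2 * n + 1).natAbs ^ 2)‖) :=
    summable_norm_pow_of_natAbs_le hz fun n => by
      have h : n.natAbs ≤ (2 * n + 1).natAbs := by omega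
      nlinarith [Nat.le_self_pow two_ne_zero (2 * n + 1).natAbs]
  refine ⟨h₄, h₈, h₂, ?_⟩
  rw [sq_tsum_eq_tsum_prod h₄, sq_tsum_eq_tsum_prod h₈, sq_tsum_eq_tsum_prod h₂]
  have hl : ∀ p : ℤ × ℤ, z ^ (8 * p.1.natAbs ^ 2) * z ^ (8 * p.2.natAbs ^ 2) =
      z ^ (4 * (p.1 + p.2).natAbs ^ 2) * z ^ (4 * (p.1 - p.2).natAbs ^ 2) := fun p => by
    rw [← pow_add, ← pow_add]
    congr 1
    zify
    simp only [sq_abs]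
    ring
  have hr : ∀ p : ℤ × ℤ,
      z ^ (2 * (2 * p.1 + 1).natAbs ^ 2) * z ^ (2 * (2 * p.2 + 1).natAbs ^ 2) =
      z ^ (4 * (p.1 + p.2 + 1).natAbs ^ 2) * z ^ (4 * (p.1 - p.2).natAbs ^ 2) := fun p => by
    rw [← pow_add, ← pow_add]
    congr 1
    zify
    simp only [sq_abs]
    ring
  rw [← intProdParityEquiv.tsum_eq]
  refine HasSum.tsum_eq (HasSum.sum ?_ ?_)
  · exact (summable_mul_of_summable_norm h₈ h₈).hasSum.congr_fun fun p => (hl p).symm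
  · exact (summable_mul_of_summable_norm h₂ h₂).hasSum.congr_fun fun p => (hr p).symm
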